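/- Let K be an abelian number field of degree d with conductor 𝔣. Then 𝔣 ≤ |Δ_K|^(2/d). -/

import Mathlib

open IntermediateField NumberField

open Polynomial in
lemma aux_minpoly_map {K L : Type*} [Field K] [Field L] [Algebra K L] [FiniteDimensional K L]
    [IsGalois K L] (x : L) (hx : K⟮x⟯ = ⊤) :
    (minpoly K x).map (algebraMap K L) = ∏ τ : L ≃ₐ[K] L, (X - C (τ x)) := by
  classical
  have hinj : Function.Injective (fun τ : L ≃ₐ[K] L => τ x) := by
    intro σ τ h
    have h2 : (σ : L →ₐ[K] L) = (τ : L →ₐ[K] L) := by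
      apply (IntermediateField.adjoin.powerBasis (Algebra.IsIntegral.isIntegral x)
        |>.map ((IntermediateField.equivOfEq hx).trans IntermediateField.topEquiv)).algHom_ext
      simpa using h
    ext y
    exact DFunLike.congr_fun h2 y
  have hint : IsIntegral K x := Algebra.IsIntegral.isIntegral x
  symm
  apply Polynomial.eq_of_monic_of_associated (monic_prod_X_sub_C _ _) ((minpoly.monic hint).map _)
  refine Polynomial.associated_of_dvd_of_natDegree_le ?_ ((minpoly.monic hint).map _).ne_zero ?_
  · apply Finset.prod_dvd_of_coprime
    · intro σ _ τ _ hst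
      exact Polynomial.pairwise_coprime_X_sub_C hinj hst
    · intro σ _
      rw [dvd_iff_isRoot, IsRoot, eval_map_algebraMap, Polynomial.aeval_algHom_apply]
      simp
  · rw [natDegree_map, natDegree_prod_of_monic _ _ (fun i _ => monic_X_sub_C _)]
    simp only [natDegree_X_sub_C, Finset.sum_const, Finset.card_univ, smul_eq_mul, mul_one]
    rw [← Nat.card_eq_fintype_card, IsGalois.card_aut_eq_finrank, ← IntermediateField.adjoin.finrank hint, hx,
      IntermediateField.finrank_top']

open Polynomial in
lemma aux_deriv {K L : Type*} [Field K] [Field L] [Algebra K L] [FiniteDimensional K L]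
    [IsGalois K L] [DecidableEq (L ≃ₐ[K] L)] (x : L) (hx : K⟮x⟯ = ⊤) :
    aeval x (derivative (minpoly K x)) = ∏ τ ∈ Finset.univ.erase (1 : L ≃ₐ[K] L), (x - τ x) := by
  rw [← eval_map_algebraMap, ← derivative_map, aux_minpoly_map x hx,
    ← Finset.mul_prod_erase _ _ (Finset.mem_univ (1 : L ≃ₐ[K] L)), derivative_mul]
  simp [eval_prod]

lemma aux_different {K L : Type*} [Field K] [Field L] [NumberField K] [NumberField L] [Algebra K L]
    [IsGalois K L] [DecidableEq (L ≃ₐ[K] L)] (x : 𝓞 L) (hx : Algebra.adjoin ℤ {x} = ⊤) :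
    ((differentIdeal (𝓞 K) (𝓞 L)).absNorm : ℚ) =
      |Algebra.norm ℚ (∏ τ ∈ Finset.univ.erase (1 : L ≃ₐ[K] L), ((x : L) - τ x))| := by
  have h1 : Algebra.adjoin (𝓞 K) {x} = ⊤ := by
    rw [eq_top_iff]
    intro y _
    have : y ∈ Algebra.adjoin ℤ {x} := hx ▸ Algebra.mem_top
    exact Algebra.adjoin_le (S := (Algebra.adjoin (𝓞 K) {x}).restrictScalars ℤ)
      (by simpa using Algebra.self_mem_adjoin_singleton _ _) this
  have h4 : ∀ a : 𝓞 L, (a : L) ∈ K⟮(x : L)⟯ := by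
    intro a
    have : a ∈ Algebra.adjoin ℤ {x} := hx ▸ Algebra.mem_top
    exact Algebra.adjoin_le (S := ((K⟮(x : L)⟯).toSubalgebra.restrictScalars ℤ).comap
      (IsScalarTower.toAlgHom ℤ (𝓞 L) L))
      (by simpa using IntermediateField.mem_adjoin_simple_self K (x : L)) this
  have h3 : K⟮(x : L)⟯ = ⊤ := by
    rw [eq_top_iff]
    intro y _
    obtain ⟨a, b, hb, rfl⟩ := IsFractionRing.div_surjective (A := 𝓞 L) y
    exact div_mem (h4 a) (h4 b)
  have h2 : Algebra.adjoin K {algebraMap (𝓞 L) L x} = ⊤ := by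
    rw [← IntermediateField.adjoin_simple_toSubalgebra_of_isAlgebraic
      (Algebra.IsAlgebraic.isAlgebraic _), h3]
    rfl
  have h := conductor_mul_differentIdeal (𝓞 K) K L x h2
  rw [conductor_eq_top_of_adjoin_eq_top h1, Ideal.top_mul] at h
  rw [h, Ideal.absNorm_span_singleton, ← aux_deriv _ h3,
    minpoly.isIntegrallyClosed_eq_field_fractions K L (Algebra.IsIntegral.isIntegral (R := 𝓞 K) x),
    Polynomial.derivative_map, Polynomial.aeval_map_algebraMap, Polynomial.aeval_algebraMap_apply]
  rw [← Algebra.coe_norm_int]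
  simp

lemma aux_norm0 {K F : Type*} [Field K] [Field F] [Algebra K F] [FiniteDimensional K F] (η : F) :
    Algebra.norm K (1 - η) = ((minpoly K η).eval 1) ^ Module.finrank K⟮η⟯ F := by
  have hint : IsIntegral K η := Algebra.IsIntegral.isIntegral η
  have : (1 - η) = algebraMap K⟮η⟯ F (1 - AdjoinSimple.gen K η) := by simp
  rw [this, ← Algebra.norm_norm (S := K⟮η⟯), Algebra.norm_algebraMap, map_pow]
  congr 1
  set pb := IntermediateField.adjoin.powerBasis hint
  have hg : AdjoinSimple.gen K η = pb.gen := by simp [pb]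
  rw [Algebra.norm_eq_matrix_det pb.basis, hg, map_sub, map_one]
  have := Matrix.eval_charpoly (Algebra.leftMulMatrix pb.basis pb.gen) 1
  rw [map_one] at this
  rw [← this, charpoly_leftMulMatrix, ← hg, IntermediateField.minpoly_gen]

lemma aux_norm {F : Type*} [Field F] [NumberField F] (η : F) (p j : ℕ) (hp : p.Prime)
    (hη : IsPrimitiveRoot η (p ^ (j+1))) :
    ∃ r, r * (p ^ (j+1)).totient = Module.finrank ℚ F ∧ Algebra.norm ℚ (1 - η) = (p : ℚ) ^ r := by
  have : Fact p.Prime := ⟨hp⟩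
  have hint : IsIntegral ℚ η := Algebra.IsIntegral.isIntegral η
  have hmin : minpoly ℚ η = Polynomial.cyclotomic (p^(j+1)) ℚ :=
    (Polynomial.cyclotomic_eq_minpoly_rat hη (pow_pos hp.pos _)).symm
  refine ⟨Module.finrank ℚ⟮η⟯ F, ?_, ?_⟩
  · rw [← Polynomial.natDegree_cyclotomic _ ℚ, ← hmin, ← IntermediateField.adjoin.finrank hint, mul_comm,
      Module.finrank_mul_finrank]
  · rw [aux_norm0, hmin, Polynomial.eval_one_cyclotomic_prime_pow]

lemma aux_disc {K L : Type*} [Field K] [Field L] [NumberField K] [NumberField L] [Algebra K L]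
    [IsGalois K L] [IsGalois ℚ L] [DecidableEq (L ≃ₐ[ℚ] L)] (x : 𝓞 L) (hx : Algebra.adjoin ℤ {x} = ⊤)
    (H : Finset (L ≃ₐ[ℚ] L)) (hH : ∀ σ, σ ∈ H ↔ ∀ k : K, σ (algebraMap K L k) = algebraMap K L k) :
    ((discr K).natAbs : ℚ) ^ Module.finrank K L =
      ∏ σ ∈ Hᶜ, |Algebra.norm ℚ ((x : L) - σ x)| := by
  classical
  have e1 := natAbs_discr_eq_absNorm_differentIdeal_mul_natAbs_discr_pow K (𝓞 K) L (𝓞 L)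
  have e2 := natAbs_discr_eq_absNorm_differentIdeal_mul_natAbs_discr_pow ℚ (𝓞 ℚ) L (𝓞 L)
  rw [e1] at e2
  simp only [Rat.numberField_discr, Int.natAbs_one, one_pow, mul_one] at e2
  have e3 := congrArg (Nat.cast (R := ℚ)) e2
  push_cast at e3
  rw [aux_different x hx, aux_different x hx] at e3
  have e4 : ∏ τ ∈ Finset.univ.erase (1 : L ≃ₐ[K] L), ((x : L) - τ x) =
      ∏ σ ∈ H.erase 1, ((x : L) - σ x) := by
    refine Finset.prod_bij (fun τ _ => τ.restrictScalars ℚ) ?_ ?_ ?_ ?_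
    · intro τ hτ
      simp only [Finset.mem_erase, Finset.mem_univ, and_true] at hτ ⊢
      refine ⟨fun h => hτ ?_, (hH _).2 fun k => by simp⟩
      ext y
      exact DFunLike.congr_fun h y
    · intro a _ b _ h
      exact AlgEquiv.restrictScalars_injective ℚ h
    · intro σ hσ
      simp only [Finset.mem_erase, Finset.mem_univ, and_true] at hσ ⊢
      refine ⟨AlgEquiv.ofRingEquiv (f := σ.toRingEquiv) ((hH σ).1 hσ.2), fun h => hσ.1 ?_, ?_⟩
      · ext y
        exact DFunLike.congr_fun h y
      · ext y; rfl
    · intro τ _; rfl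
  have h1H : (1 : L ≃ₐ[ℚ] L) ∈ H := (hH 1).2 (by simp)
  have e5 : ∏ σ ∈ Finset.univ.erase (1 : L ≃ₐ[ℚ] L), ((x : L) - σ x) =
      (∏ σ ∈ H.erase 1, ((x : L) - σ x)) * ∏ σ ∈ Hᶜ, ((x : L) - σ x) := by
    rw [← Finset.prod_union]
    · congr 1
      ext σ
      simp only [Finset.mem_erase, Finset.mem_univ, and_true, Finset.mem_union, Finset.mem_compl]
      by_cases h : σ ∈ H
      · simp [h]
      · simp [h]; rintro rfl; exact h h1H
    · rw [Finset.disjoint_left]; intro σ h; simp at h ⊢; exact h.2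
  have hne : |Algebra.norm ℚ (∏ σ ∈ H.erase 1, ((x : L) - σ x))| ≠ 0 := by
    rw [← e4, ← aux_different x hx]
    intro h
    norm_cast at h
    rw [h, zero_mul] at e1
    exact NumberField.discr_ne_zero L (Int.natAbs_eq_zero.1 e1)
  rw [e4, e5, map_mul, abs_mul] at e3
  rw [mul_left_cancel₀ hne e3, map_prod, Finset.abs_prod]

lemma aux_sum_tot (p : ℕ) (hp : p.Prime) (k : ℕ) :
    ∑ i ∈ Finset.range (k+1), (p ^ i).totient = p ^ k := by
  rw [← Nat.sum_divisors_prime_pow hp, Nat.sum_totient]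

open Classical in
lemma aux_weight {L : Type*} [Field L] [NumberField L] (p a m : ℕ) (hp : p.Prime)
    (hpm : ¬ p ∣ m) (hL : Module.finrank ℚ L = (p ^ a * m).totient) (hm : 0 < m)
    (x : 𝓞 L) (hζ : IsPrimitiveRoot (x : L) (p ^ a * m)) (σ : L ≃ₐ[ℚ] L) (hσ : σ x ≠ x) :
    ((m.totient * ∑ i ∈ Finset.range a,
      (if σ ((x : L) ^ p ^ (a - i)) = (x : L) ^ p ^ (a - i) then (p ^ i).totient else 0) : ℕ) : ℤ) ≤
    padicValRat p |Algebra.norm ℚ ((x : L) - σ x)| := by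
  have : Fact p.Prime := ⟨hp⟩
  have hx0 : (x : L) ≠ 0 := hζ.ne_zero (Nat.mul_pos (pow_pos hp.pos _) hm).ne'
  set η : L := σ x * (x : L)⁻¹ with hη
  have hσx : σ x = η * x := by rw [hη, inv_mul_cancel_right₀ hx0]
  have hη1 : η ≠ 1 := by
    intro h
    exact hσ (by rw [hσx, h, one_mul])
  have hpow : ∀ t : ℕ, σ ((x : L) ^ t) = (x : L) ^ t ↔ η ^ t = 1 := by
    intro t
    rw [map_pow, hσx, mul_pow]
    exact mul_eq_right₀ (pow_ne_zero _ hx0)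
  simp only [hpow]
  by_cases h : η ^ p ^ a = 1
  · obtain ⟨k, hka, hk⟩ := (Nat.dvd_prime_pow hp).1 (orderOf_dvd_of_pow_eq_one h)
    obtain _ | j := k
    · rw [pow_zero, orderOf_eq_one_iff] at hk
      exact absurd hk hη1
    have hprim : IsPrimitiveRoot η (p ^ (j+1)) := hk ▸ IsPrimitiveRoot.orderOf η
    obtain ⟨r, hr, hN⟩ := aux_norm η p j hp hprim
    have hNx : |Algebra.norm ℚ (x : L)| = 1 := by
      have h1 : |Algebra.norm ℚ (x : L)| ^ (p ^ a * m) = 1 := by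
        rw [← abs_pow, ← map_pow, hζ.pow_eq_one, map_one, abs_one]
      exact (pow_eq_one_iff_of_nonneg (abs_nonneg _) (Nat.mul_pos (pow_pos hp.pos _) hm).ne').1 h1
    have hval : |Algebra.norm ℚ ((x : L) - σ x)| = (p : ℚ) ^ r := by
      have : (x : L) - σ x = (1 - η) * x := by rw [hσx]; ring
      rw [this, map_mul, abs_mul, hNx, mul_one, hN, abs_of_nonneg (by positivity)]
    rw [hval, padicValRat.pow, padicValRat.self hp.one_lt, mul_one]
    · norm_cast
      have hsum : ∑ i ∈ Finset.range a, (if η ^ p ^ (a - i) = 1 then (p ^ i).totient else 0) ≤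
          p ^ (a - (j+1)) := by
        rw [← aux_sum_tot p hp, ← Finset.sum_filter]
        apply Finset.sum_le_sum_of_subset
        intro i hi
        simp only [Finset.mem_filter, Finset.mem_range] at hi ⊢
        have := orderOf_dvd_of_pow_eq_one hi.2
        rw [hk, Nat.pow_dvd_pow_iff_le_right hp.one_lt] at this
        omega
      refine (Nat.mul_le_mul_left _ hsum).trans (le_of_eq ?_)
      have hcop : (p ^ a).Coprime m := Nat.Coprime.pow_left _ ((Nat.Prime.coprime_iff_not_dvd hp).2 hpm)
      rw [hL, Nat.totient_mul hcop] at hr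
      obtain ⟨b, rfl⟩ := Nat.exists_eq_add_of_le' hka
      rw [← add_assoc, Nat.totient_prime_pow_succ hp, Nat.totient_prime_pow_succ hp] at hr
      have hpos : 0 < p ^ j * (p - 1) := Nat.mul_pos (pow_pos hp.pos _) (by have := hp.two_le; omega)
      apply Nat.eq_of_mul_eq_mul_right hpos
      rw [hr, Nat.add_sub_cancel, pow_add]
      ring
  · have h0 : ∀ i ∈ Finset.range a, (if η ^ p ^ (a - i) = 1 then (p ^ i).totient else 0) = 0 := by
      intro i hi
      rw [if_neg]
      intro h2
      apply h
      have : p ^ a = p ^ (a - i) * p ^ i := by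
        rw [← pow_add]; congr 1; have := Finset.mem_range.1 hi; omega
      rw [this, pow_mul, h2, one_pow]
    rw [Finset.sum_eq_zero h0]
    have hi : IsIntegral ℤ (Algebra.norm ℚ ((x : L) - σ x)) := by
      apply Algebra.isIntegral_norm
      exact x.2.sub (x.2.map (σ.restrictScalars ℤ))
    obtain ⟨z, hz⟩ := IsIntegrallyClosed.isIntegral_iff.1 hi
    rw [← hz]
    simp only [eq_intCast, ← Int.cast_abs, padicValRat.of_int]
    simp

open Classical in
lemma aux_half {G : Type*} [Group G] [Fintype G] (V H : Subgroup G) (g : G) (hg : g ∈ V)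
    (hgH : g ∉ H) :
    Fintype.card V ≤ 2 * (Finset.univ.filter (fun σ => σ ∉ H ∧ σ ∈ V)).card := by
  have h1 : Fintype.card V = (Finset.univ.filter (fun σ => σ ∈ V)).card :=
    Fintype.card_subtype _
  have h2 : (Finset.univ.filter (fun σ => σ ∈ V)).card =
      (Finset.univ.filter (fun σ => σ ∉ H ∧ σ ∈ V)).card +
      (Finset.univ.filter (fun σ => σ ∈ H ∧ σ ∈ V)).card := by
    rw [← Finset.card_union_of_disjoint]
    · congr 1
      ext σ
      simp
      tauto
    · rw [Finset.disjoint_left]; intro σ; simp; tauto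
  have h3 : (Finset.univ.filter (fun σ => σ ∈ H ∧ σ ∈ V)).card ≤
      (Finset.univ.filter (fun σ => σ ∉ H ∧ σ ∈ V)).card := by
    apply Finset.card_le_card_of_injOn (fun σ => g * σ)
    · intro σ hσ
      simp only [Finset.coe_filter, Finset.mem_univ, true_and, Set.mem_ofPred_eq] at hσ ⊢
      exact ⟨fun h => hgH ((H.mul_mem_cancel_right hσ.1).1 h), V.mul_mem hg hσ.2⟩
    · intro a _ b _ h
      exact mul_left_cancel h
  omega

lemma aux_val {K L : Type*} [Field K] [Field L] [NumberField K] [NumberField L] [Algebra K L]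
    [IsGalois K L] [IsGalois ℚ L] (p a m : ℕ) (hp : p.Prime)
    (hpm : ¬ p ∣ m) (hL : Module.finrank ℚ L = (p ^ a * m).totient) (hm : 0 < m)
    (x : 𝓞 L) (hζ : IsPrimitiveRoot (x : L) (p ^ a * m)) (hx : Algebra.adjoin ℤ {x} = ⊤)
    (hmin : ∃ σ : L ≃ₐ[ℚ] L, σ ((x : L) ^ p) = (x : L) ^ p ∧
      ∃ k : K, σ (algebraMap K L k) ≠ algebraMap K L k) :
    a * Module.finrank ℚ L ≤ 2 * Module.finrank K L * (discr K).natAbs.factorization p := by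
  classical
  have : Fact p.Prime := ⟨hp⟩
  obtain ⟨g, hg, k, hk⟩ := hmin
  let H : Subgroup (L ≃ₐ[ℚ] L) := ((IsScalarTower.toAlgHom ℚ K L).fieldRange).fixingSubgroup
  have hHm : ∀ σ, σ ∈ H ↔ ∀ k : K, σ (algebraMap K L k) = algebraMap K L k := by
    intro σ
    simp [H, IntermediateField.mem_fixingSubgroup_iff]
  have hgH : g ∉ H := fun h => hk ((hHm g).1 h k)
  let V : ℕ → Subgroup (L ≃ₐ[ℚ] L) := fun i => (ℚ⟮(x : L) ^ p ^ (a - i)⟯).fixingSubgroup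
  have hVm : ∀ i σ, σ ∈ V i ↔ σ ((x : L) ^ p ^ (a - i)) = (x : L) ^ p ^ (a - i) := by
    intro i σ
    refine ⟨fun h => (IntermediateField.mem_fixingSubgroup_iff _ _).1 h _
      (IntermediateField.mem_adjoin_simple_self _ _), fun h => ?_⟩
    have h2 : ℚ⟮(x : L) ^ p ^ (a - i)⟯ ≤ IntermediateField.fixedField (Subgroup.zpowers σ) := by
      rw [IntermediateField.adjoin_simple_le_iff, IntermediateField.mem_fixedField_iff]
      intro τ hτ
      have h3 : σ ∈ MulAction.stabilizer (L ≃ₐ[ℚ] L) ((x : L) ^ p ^ (a - i)) := h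
      exact (Subgroup.zpowers_le.2 h3) hτ
    exact (IntermediateField.le_iff_le _ _).1 h2 (Subgroup.mem_zpowers σ)
  have hf0 : p ^ a * m ≠ 0 := (Nat.mul_pos (pow_pos hp.pos _) hm).ne'
  have hcard : ∀ i ∈ Finset.range a, m.totient * (p ^ i).totient * Fintype.card (V i) =
      Module.finrank ℚ L := by
    intro i hi
    have hi := Finset.mem_range.1 hi
    have hprim : IsPrimitiveRoot ((x : L) ^ p ^ (a - i)) (m * p ^ i) := by
      refine hζ.pow (Nat.pos_of_ne_zero hf0) ?_
      rw [show p ^ a = p ^ (a - i) * p ^ i by rw [← pow_add]; congr 1; omega]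
      ring
    have hcop : m.Coprime (p ^ i) := (Nat.Coprime.pow_left _ ((Nat.Prime.coprime_iff_not_dvd hp).2 hpm)).symm
    have h1 : Module.finrank ℚ ℚ⟮(x : L) ^ p ^ (a - i)⟯ = (m * p ^ i).totient := by
      rw [IntermediateField.adjoin.finrank (Algebra.IsIntegral.isIntegral _),
        ← Polynomial.cyclotomic_eq_minpoly_rat hprim (Nat.mul_pos hm (pow_pos hp.pos _)),
        Polynomial.natDegree_cyclotomic]
    have h2 : Fintype.card (V i) = Module.finrank ℚ⟮(x : L) ^ p ^ (a - i)⟯ L := by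
      rw [← Nat.card_eq_fintype_card]
      exact IsGalois.card_fixingSubgroup_eq_finrank _
    rw [h2, ← Nat.totient_mul hcop, ← h1, Module.finrank_mul_finrank]
  have hgV : ∀ i ∈ Finset.range a, g ∈ V i := by
    intro i hi
    have hi := Finset.mem_range.1 hi
    rw [hVm]
    have : p ^ (a - i) = p * p ^ (a - i - 1) := by rw [← pow_succ']; congr 1; omega
    rw [this, pow_mul, map_pow, hg]
  have hD := aux_disc (K := K) x hx (Finset.univ.filter (· ∈ H)) (by intro σ; simp [hHm])
  have hfix : ∀ σ : L ≃ₐ[ℚ] L, σ ∉ H → σ x ≠ x := by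
    intro σ hσ h
    apply hσ
    have : ∀ y : 𝓞 L, σ y = y := by
      intro y
      have hy : y ∈ Algebra.adjoin ℤ {x} := hx ▸ Algebra.mem_top
      induction hy using Algebra.adjoin_induction with
      | mem y hy => rw [Set.mem_singleton_iff.1 hy]; exact h
      | algebraMap r => simp
      | add a b _ _ ha hb => simp [ha, hb]
      | mul a b _ _ ha hb => simp [ha, hb]
    rw [hHm]
    intro k
    obtain ⟨a, b, hb, hab⟩ := IsFractionRing.div_surjective (A := 𝓞 L) (algebraMap K L k)
    rw [← hab, map_div₀]
    exact congrArg₂ _ (this a) (this b)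
  have hval := congrArg (padicValRat p) hD
  have hd0 : ((discr K).natAbs : ℚ) ≠ 0 := by
    exact_mod_cast Int.natAbs_ne_zero.2 (discr_ne_zero K)
  have hne : ∀ σ ∈ (Finset.univ.filter (· ∈ H))ᶜ, |Algebra.norm ℚ ((x : L) - σ x)| ≠ 0 := by
    intro σ hσ h0
    rw [Finset.prod_eq_zero hσ h0] at hD
    exact pow_ne_zero _ hd0 hD
  have hprodval : ∀ s : Finset (L ≃ₐ[ℚ] L), s ⊆ (Finset.univ.filter (· ∈ H))ᶜ →
      padicValRat p (∏ σ ∈ s, |Algebra.norm ℚ ((x : L) - σ x)|) =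
      ∑ σ ∈ s, padicValRat p |Algebra.norm ℚ ((x : L) - σ x)| := by
    intro s
    induction s using Finset.induction_on with
    | empty => simp
    | insert b s hb ih =>
      intro hs
      rw [Finset.prod_insert hb, Finset.sum_insert hb, padicValRat.mul, ih]
      · exact (Finset.subset_insert _ _).trans hs
      · exact hne b (hs (Finset.mem_insert_self _ _))
      · exact Finset.prod_ne_zero_iff.2 fun c hc => hne c (hs (Finset.mem_insert_of_mem hc))
  rw [hprodval _ subset_rfl, padicValRat.pow, padicValRat.of_nat] at hval
  have hle : ∑ σ ∈ (Finset.univ.filter (· ∈ H))ᶜ, ((m.totient * ∑ i ∈ Finset.range a,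
      (if σ ∈ V i then (p ^ i).totient else 0) : ℕ) : ℤ) ≤
      Module.finrank K L * (padicValNat p (discr K).natAbs : ℤ) := by
    rw [hval]
    apply Finset.sum_le_sum
    intro σ hσ
    simp only [hVm]
    exact aux_weight p a m hp hpm hL hm x hζ σ (hfix σ (by simpa using hσ))
  norm_cast at hle
  rw [Nat.factorization_def _ hp, mul_assoc]
  refine le_trans ?_ (Nat.mul_le_mul_left 2 hle)
  rw [← Finset.mul_sum, Finset.sum_comm, Finset.mul_sum, Finset.mul_sum]
  have : a * Module.finrank ℚ L = ∑ i ∈ Finset.range a, Module.finrank ℚ L := by simp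
  rw [this]
  apply Finset.sum_le_sum
  intro i hi
  rw [← hcard i hi, ← Finset.sum_filter, Finset.sum_const, smul_eq_mul]
  have h5 := aux_half (V i) H g (hgV i hi) hgH
  have h6 : (Finset.univ.filter (· ∈ H))ᶜ.filter (fun σ => σ ∈ V i) =
      Finset.univ.filter (fun σ => σ ∉ H ∧ σ ∈ V i) := by
    ext σ; simp
  rw [h6]
  calc _ ≤ m.totient * (p ^ i).totient * _ := Nat.mul_le_mul_left _ (le_of_eq_of_le (by congr!) h5)
    _ = _ := by ring

lemma aux_core {K L : Type*} [Field K] [Field L] [NumberField K] [NumberField L] [Algebra K L]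
    (f : ℕ) [NeZero f] [IsCyclotomicExtension {f} ℚ L] (ζ : L) (hζ : IsPrimitiveRoot ζ f)
    (hmin : ∀ p : ℕ, p.Prime → p ∣ f → ∃ σ : L ≃ₐ[ℚ] L, σ (ζ ^ p) = ζ ^ p ∧
      ∃ k : K, σ (algebraMap K L k) ≠ algebraMap K L k) :
    f ^ Module.finrank ℚ K ≤ (discr K).natAbs ^ 2 := by
  have : IsGalois ℚ L := IsCyclotomicExtension.isGalois {f} ℚ L
  have : IsGalois K L := IsGalois.tower_top_of_isGalois ℚ K L
  have hL : Module.finrank ℚ L = f.totient := IsCyclotomicExtension.Rat.finrank f L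
  have hx := IsCyclotomicExtension.Rat.adjoin_singleton_eq_top hζ
  have hd0 : (discr K).natAbs ≠ 0 := Int.natAbs_ne_zero.2 (discr_ne_zero K)
  have hf0 : f ≠ 0 := NeZero.ne f
  have hdvd : f ^ Module.finrank ℚ L ∣ (discr K).natAbs ^ (2 * Module.finrank K L) := by
    rw [← Nat.factorization_le_iff_dvd (pow_ne_zero _ hf0) (pow_ne_zero _ hd0)]
    intro p
    simp only [Nat.factorization_pow, Finsupp.smul_apply, smul_eq_mul]
    by_cases hp : p.Prime ∧ p ∣ f
    · obtain ⟨hp, hpf⟩ := hp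
      have hfe : p ^ f.factorization p * (f / p ^ f.factorization p) = f := Nat.ordProj_mul_ordCompl_eq_self f p
      rw [mul_comm]
      exact aux_val p (f.factorization p) (f / p ^ f.factorization p) hp
        (Nat.not_dvd_ordCompl hp hf0) (by rw [hfe, hL]) (Nat.ordCompl_pos p hf0) hζ.toInteger
        (by rw [hfe]; exact hζ) hx (hmin p hp hpf)
    · rw [Nat.factorization_eq_zero_iff f p |>.2 (by tauto)]
      simp
  have hle := Nat.le_of_dvd (Nat.pos_of_ne_zero (pow_ne_zero _ hd0)) hdvd
  rw [← Module.finrank_mul_finrank ℚ K L, pow_mul, pow_mul] at hle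
  exact (Nat.pow_le_pow_iff_left (Module.finrank_pos (R := K) (M := L)).ne').1 hle

lemma aux_cyc {K L : Type*} [Field K] [Field L] [Algebra K L] {n : ℕ} [NeZero n] {ζ : L}
    (hζ : IsPrimitiveRoot ζ n) : IsCyclotomicExtension {n} K (IntermediateField.adjoin K {ζ}) := by
  change IsCyclotomicExtension {n} K (IntermediateField.adjoin K {ζ}).toSubalgebra
  rw [IntermediateField.adjoin_simple_toSubalgebra_of_isAlgebraic
    (hζ.isIntegral (NeZero.pos n)).tower_top.isAlgebraic]
  exact hζ.adjoin_isCyclotomicExtension K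

/-- For an abelian number field `K ⊆ ℂ` of degree `d` with conductor `𝔣` (the least
positive integer `f` with `K ⊆ ℚ(ζ_f)`), one has `𝔣 ≤ |Δ_K|^(2/d)`. -/
theorem conductor_le_discr_pow (K : IntermediateField ℚ ℂ) [NumberField K]
    [IsGalois ℚ K] (habelian : ∀ σ τ : (K ≃ₐ[ℚ] K), σ * τ = τ * σ)
    (d : ℕ) (hd : Module.finrank ℚ K = d) (𝔣 : ℕ)
    (h𝔣 : IsLeast {f : ℕ | 0 < f ∧
        K ≤ ℚ⟮Complex.exp (2 * Real.pi * Complex.I / f)⟯} 𝔣) :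
    (𝔣 : ℝ) ≤ |(discr K : ℝ)| ^ ((2 : ℝ) / d) := by
  obtain ⟨⟨hf0, hK⟩, hleast⟩ := h𝔣
  have : NeZero 𝔣 := ⟨hf0.ne'⟩
  have hprim := Complex.isPrimitiveRoot_exp 𝔣 hf0.ne'
  set L : IntermediateField ℚ ℂ := ℚ⟮Complex.exp (2 * Real.pi * Complex.I / 𝔣)⟯ with hLdef
  have hcyc : IsCyclotomicExtension {𝔣} ℚ L :=
    aux_cyc hprim
  have : NumberField L := IsCyclotomicExtension.numberField {𝔣} ℚ L
  have : IsGalois ℚ L := IsCyclotomicExtension.isGalois {𝔣} ℚ L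
  let _ : Algebra K L := (IntermediateField.inclusion hK).toRingHom.toAlgebra
  let ζ : L := ⟨_, IntermediateField.mem_adjoin_simple_self ℚ _⟩
  have hζ : IsPrimitiveRoot ζ 𝔣 :=
    IsPrimitiveRoot.of_map_of_injective (f := L.val) hprim L.val.injective
  have hcore := aux_core (K := K) 𝔣 ζ hζ (by
    intro p hp hpf
    by_contra hcon
    push Not at hcon
    obtain ⟨n, rfl⟩ := hpf
    have hn : 0 < n := Nat.pos_of_mul_pos_left hf0
    have hlt : n < p * n := by have := hp.two_le; nlinarith
    refine absurd (hleast ⟨hn, ?_⟩) (not_le.2 hlt)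
    have hexp : Complex.exp (2 * Real.pi * Complex.I / n) = L.val (ζ ^ p) := by
      rw [map_pow]
      change _ = Complex.exp _ ^ p
      rw [← Complex.exp_nat_mul]
      congr 1
      have : (p : ℂ) ≠ 0 := by exact_mod_cast hp.ne_zero
      have : (n : ℂ) ≠ 0 := by exact_mod_cast hn.ne'
      push_cast
      field_simp
    intro k hk
    have hmem : algebraMap K L ⟨k, hk⟩ ∈ ℚ⟮ζ ^ p⟯ := by
      rw [← IsGalois.fixedField_fixingSubgroup (ℚ⟮ζ ^ p⟯), IntermediateField.mem_fixedField_iff]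
      intro σ hσ
      exact hcon σ ((IntermediateField.mem_fixingSubgroup_iff _ _).1 hσ _
        (IntermediateField.mem_adjoin_simple_self _ _)) _
    have h2 : ℚ⟮ζ ^ p⟯ ≤ (ℚ⟮Complex.exp (2 * Real.pi * Complex.I / n)⟯).comap
        (L.val : L →+* ℂ).toRatAlgHom := by
      rw [IntermediateField.adjoin_simple_le_iff]
      change L.val (ζ ^ p) ∈ ℚ⟮Complex.exp (2 * Real.pi * Complex.I / n)⟯
      rw [← hexp]
      exact IntermediateField.mem_adjoin_simple_self _ _
    exact h2 hmem)
  rw [hd] at hcore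
  have hdpos : 0 < d := hd ▸ Module.finrank_pos
  have habs : |(discr K : ℝ)| = ((discr K).natAbs : ℝ) := by
    rw [Nat.cast_natAbs, Int.cast_abs]
  have hR : ((𝔣 : ℝ)) ^ d ≤ |(discr K : ℝ)| ^ 2 := by
    rw [habs]; exact_mod_cast hcore
  have hd' : (d : ℝ) ≠ 0 := by exact_mod_cast hdpos.ne'
  calc (𝔣 : ℝ) = ((𝔣 : ℝ) ^ d) ^ ((1 : ℝ) / d) := by
        rw [← Real.rpow_natCast, ← Real.rpow_mul (by positivity), mul_one_div_cancel hd', Real.rpow_one]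
    _ ≤ (|(discr K : ℝ)| ^ 2) ^ ((1 : ℝ) / d) :=
        Real.rpow_le_rpow (by positivity) hR (by positivity)
    _ = _ := by
        rw [← Real.rpow_natCast, ← Real.rpow_mul (abs_nonneg _)]
        congr 1
        push_cast
        ring
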